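/- For every real number ρ, the function y ↦ sin(ρy)/sinh(y/2) (defined for y ≠ 0; its singularity at y = 0 is removable) is integrable on ℝ and ∫_{−∞}^{+∞} sin(ρy)/sinh(y/2) dy = 2π tanh(πρ). -/

import Mathlib

open Real MeasureTheory

open Filter Topology in
/-- The partial fraction expansion of `tanh`, obtained from that of `cot` at `1 / 2 + ρ * I`. -/
theorem tendsto_sum_partial_fractions_tanh (ρ : ℝ) :
    Tendsto (fun N : ℕ => ∑ n ∈ Finset.range N, 2 * ρ / (((n : ℝ) + 1 / 2) ^ 2 + ρ ^ 2)) atTop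
      (𝓝 (π * Real.tanh (π * ρ))) := by
  set x : ℂ := 1 / 2 + ρ * Complex.I with hx_def
  have hre : x.re = 1 / 2 := by simp [hx_def]
  have hx : x ∈ Complex.integerComplement := by
    rw [Complex.mem_integerComplement_iff]
    rintro ⟨n, hn⟩
    have h : ((n : ℝ)) = 1 / 2 := by rw [← hre, ← hn]; simp
    have h' : ((2 * n : ℤ) : ℝ) = (1 : ℤ) := by push_cast; linarith
    have := Int.cast_injective h'
    omega
  have hcot : Complex.cot (π * x) = -(Real.tanh (π * ρ) : ℂ) * Complex.I := by
    have h : (π : ℂ) * x = (π * ρ : ℝ) * Complex.I + π / 2 := by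
      rw [hx_def]; push_cast; ring
    rw [h, Complex.cot, Complex.cos_add_pi_div_two, Complex.sin_add_pi_div_two,
      Complex.sin_mul_I, Complex.cos_mul_I, Complex.ofReal_tanh, Complex.tanh_eq_sinh_div_cosh]
    ring
  have hne : ∀ n : ℕ, x + n ≠ 0 := fun n => by
    simpa using Complex.integerComplement_add_ne_zero hx n
  have hne' : ∀ n : ℕ, x - (n + 1) ≠ 0 := fun n => by
    have := Complex.integerComplement_add_ne_zero hx (-(n + 1))
    push_cast at this
    rwa [← sub_eq_add_neg] at this
  have hsum : ∀ N : ℕ, ∑ n ∈ Finset.range N, cotTerm x n =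
      -Complex.I * ((∑ n ∈ Finset.range N, 2 * ρ / (((n : ℝ) + 1 / 2) ^ 2 + ρ ^ 2) : ℝ) : ℂ)
        + 1 / (x + N) - 1 / x := by
    intro N
    induction N with
    | zero => simp
    | succ N ih =>
      have hterm : 1 / (x + N) + 1 / (x - (N + 1)) =
          -Complex.I * ((2 * ρ / (((N : ℝ) + 1 / 2) ^ 2 + ρ ^ 2) : ℝ) : ℂ) := by
        have hprod : (x + N) * (x - (N + 1)) = -(((N : ℂ) + 1 / 2) ^ 2 + ρ ^ 2) := by
          rw [hx_def]; linear_combination (ρ : ℂ) ^ 2 * Complex.I_sq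
        have hden : ((N : ℂ) + 1 / 2) ^ 2 + ρ ^ 2 ≠ 0 := by
          rw [← neg_ne_zero, ← hprod]
          exact mul_ne_zero (hne N) (hne' N)
        rw [one_div_add_one_div (hne N) (hne' N), hprod]
        push_cast
        rw [div_neg, ← neg_div, ← mul_div_assoc, hx_def]
        congr 1
        ring
      rw [Finset.sum_range_succ, Finset.sum_range_succ, ih, cotTerm, Complex.ofReal_add, mul_add,
        ← hterm]
      push_cast
      ring
  have hlim := tendsto_logDeriv_euler_cot_sub hx
  rw [hcot] at hlim
  have hzero : Tendsto (fun N : ℕ => 1 / (x + N)) atTop (𝓝 0) := by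
    simp_rw [one_div]
    exact tendsto_inv₀_cobounded.comp
      (tendsto_const_add_cobounded _ |>.comp tendsto_natCast_atTop_cobounded)
  have hlim' := ((hlim.sub hzero).add_const (1 / x)).const_mul Complex.I
  have him := (Complex.continuous_re.tendsto _).comp hlim'
  convert him using 1
  · funext N
    have : Complex.I * (∑ n ∈ Finset.range N, cotTerm x n - 1 / (x + N) + 1 / x) =
        ((∑ n ∈ Finset.range N, 2 * ρ / (((n : ℝ) + 1 / 2) ^ 2 + ρ ^ 2) : ℝ) : ℂ) := by
      rw [hsum]
      linear_combination
        -((∑ n ∈ Finset.range N, 2 * ρ / (((n : ℝ) + 1 / 2) ^ 2 + ρ ^ 2) : ℝ) : ℂ) * Complex.I_sq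
    simp only [Function.comp_apply]
    rw [this, Complex.ofReal_re]
  · have : Complex.I * (π * (-(Real.tanh (π * ρ) : ℂ) * Complex.I) - 1 / x - 0 + 1 / x) =
        ((π * Real.tanh (π * ρ) : ℝ) : ℂ) := by
      push_cast
      linear_combination -(π : ℂ) * Complex.tanh (π * ρ) * Complex.I_sq
    rw [this, Complex.ofReal_re]

/-- The Laplace transform of the sine, with the integrability of the integrand. -/
theorem integral_sin_mul_exp_neg_mul_Ioi (ρ : ℝ) {a : ℝ} (ha : 0 < a) :
    IntegrableOn (fun y : ℝ => Real.sin (ρ * y) * Real.exp (-a * y)) (Set.Ioi 0) ∧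
    ∫ y in Set.Ioi (0 : ℝ), Real.sin (ρ * y) * Real.exp (-a * y) = ρ / (a ^ 2 + ρ ^ 2) := by
  set c : ℂ := -a + ρ * Complex.I with hc_def
  have hc : c.re < 0 := by simpa [hc_def] using ha
  have him : ∀ y : ℝ, Real.sin (ρ * y) * Real.exp (-a * y) = RCLike.im (Complex.exp (c * y)) := by
    intro y
    rw [RCLike.im_eq_complex_im, Complex.exp_im]
    simp [hc_def, mul_comm]
  simp_rw [him]
  have hint := integrableOn_exp_mul_complex_Ioi hc 0
  refine ⟨hint.im, ?_⟩
  rw [integral_im hint, integral_exp_mul_complex_Ioi hc 0]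
  simp [hc_def, Complex.div_im, Complex.normSq_apply]
  ring

theorem sum_range_exp_neg_eq_div_sinh {y : ℝ} (hy : y ≠ 0) (N : ℕ) :
    ∑ n ∈ Finset.range N, 2 * Real.exp (-((n : ℝ) + 1 / 2) * y) =
      (1 - Real.exp (-N * y)) / Real.sinh (y / 2) := by
  have hs : Real.sinh (y / 2) ≠ 0 := by simpa [Real.sinh_eq_zero] using hy
  rw [eq_div_iff hs]
  induction N with
  | zero => simp
  | succ N ih =>
    rw [Finset.sum_range_succ, add_mul, ih, Real.sinh_eq]
    have h1 : Real.exp (-((N : ℝ) + 1 / 2) * y) * Real.exp (y / 2) = Real.exp (-N * y) := by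
      rw [← Real.exp_add]; ring_nf
    have h2 : Real.exp (-((N : ℝ) + 1 / 2) * y) * Real.exp (-(y / 2)) =
        Real.exp (-(N + 1 : ℕ) * y) := by
      rw [← Real.exp_add]; push_cast; ring_nf
    linear_combination h1 - h2

theorem norm_sin_div_sinh_le (ρ y : ℝ) :
    ‖Real.sin (ρ * y) / Real.sinh (y / 2)‖ ≤ 4 * |ρ| * Real.exp (-(1 / 4) * |y|) := by
  rcases eq_or_ne y 0 with rfl | hy
  · simp
  have hy' : 0 < |y| := abs_pos.mpr hy
  have hsin : |Real.sin (ρ * y)| ≤ |ρ| * |y| := by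
    rw [← abs_mul]; exact Real.abs_sin_le_abs
  have hsinh : |y| / 4 * Real.exp (|y| / 4) ≤ |Real.sinh (y / 2)| := by
    rw [Real.abs_sinh, abs_div, abs_two, show |y| / 2 = 2 * (|y| / 4) by ring, Real.sinh_two_mul]
    have h1 : |y| / 4 ≤ Real.sinh (|y| / 4) := Real.self_le_sinh_iff.mpr (by positivity)
    have h2 : Real.exp (|y| / 4) ≤ 2 * Real.cosh (|y| / 4) := by
      rw [Real.cosh_eq]; linarith [Real.exp_pos (-(|y| / 4))]
    calc |y| / 4 * Real.exp (|y| / 4)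
        ≤ Real.sinh (|y| / 4) * (2 * Real.cosh (|y| / 4)) :=
          mul_le_mul h1 h2 (Real.exp_pos _).le (le_trans (by positivity) h1)
      _ = _ := by ring
  rw [Real.norm_eq_abs, abs_div, div_le_iff₀ (lt_of_lt_of_le (by positivity) hsinh)]
  calc |Real.sin (ρ * y)| ≤ |ρ| * |y| := hsin
    _ = 4 * |ρ| * Real.exp (-(1 / 4) * |y|) * (|y| / 4 * Real.exp (|y| / 4)) := by
      have : Real.exp (-(1 / 4) * |y|) * Real.exp (|y| / 4) = 1 := by
        rw [← Real.exp_add, Real.exp_eq_one_iff]; ring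
      linear_combination -(|ρ| * |y|) * this
    _ ≤ _ := by gcongr

theorem integrable_sin_div_sinh (ρ : ℝ) :
    Integrable (fun y : ℝ => Real.sin (ρ * y) / Real.sinh (y / 2)) := by
  have hexp : Integrable (fun y : ℝ => Real.exp (-(1 / 4) * |y|)) :=
    Integrable.of_integral_ne_zero <| by
      rw [integral_comp_abs (f := fun y => Real.exp (-(1 / 4) * y)),
        integral_exp_mul_Ioi (by norm_num)]
      norm_num
  refine (hexp.const_mul (4 * |ρ|)).mono' ?_ (ae_of_all _ (norm_sin_div_sinh_le ρ))
  exact Measurable.aestronglyMeasurable (by fun_prop)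

open Filter Topology in
theorem integral_Ioi_sin_div_sinh (ρ : ℝ) :
    ∫ y in Set.Ioi (0 : ℝ), Real.sin (ρ * y) / Real.sinh (y / 2) = π * Real.tanh (π * ρ) := by
  have hpartial : ∀ N : ℕ, ∫ y in Set.Ioi (0 : ℝ),
      Real.sin (ρ * y) / Real.sinh (y / 2) * (1 - Real.exp (-N * y)) =
        ∑ n ∈ Finset.range N, 2 * ρ / (((n : ℝ) + 1 / 2) ^ 2 + ρ ^ 2) := by
    intro N
    have hlap := fun n : ℕ =>
      integral_sin_mul_exp_neg_mul_Ioi ρ (a := (n : ℝ) + 1 / 2) (by positivity)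
    calc _ = ∫ y in Set.Ioi (0 : ℝ), ∑ n ∈ Finset.range N,
          2 * (Real.sin (ρ * y) * Real.exp (-((n : ℝ) + 1 / 2) * y)) := by
            refine setIntegral_congr_fun measurableSet_Ioi fun y hy => ?_
            rw [div_mul_eq_mul_div, mul_div_assoc, ← sum_range_exp_neg_eq_div_sinh (ne_of_gt hy),
              Finset.mul_sum]
            exact Finset.sum_congr rfl fun n _ => by ring
      _ = _ := by
            rw [integral_finsetSum _ fun n _ => (hlap n).1.const_mul 2]
            refine Finset.sum_congr rfl fun n _ => ?_
            rw [integral_const_mul, (hlap n).2, mul_div_assoc]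
  refine tendsto_nhds_unique ?_ (tendsto_sum_partial_fractions_tanh ρ)
  simp_rw [← hpartial]
  refine tendsto_integral_of_dominated_convergence
    (fun y => ‖Real.sin (ρ * y) / Real.sinh (y / 2)‖) (fun N => ?_)
    (integrable_sin_div_sinh ρ).norm.integrableOn (fun N => ?_) ?_
  · exact Measurable.aestronglyMeasurable (by fun_prop)
  · refine (ae_restrict_mem measurableSet_Ioi).mono fun y hy => ?_
    rw [norm_mul]
    refine mul_le_of_le_one_right (norm_nonneg _) ?_
    have hy : 0 < y := hy
    have h : Real.exp (-N * y) ≤ 1 := by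
      rw [Real.exp_le_one_iff, neg_mul]
      exact neg_nonpos.mpr (by positivity)
    rw [Real.norm_of_nonneg (by linarith)]
    linarith [Real.exp_pos (-N * y)]
  · refine (ae_restrict_mem measurableSet_Ioi).mono fun y hy => ?_
    have h : Tendsto (fun N : ℕ => Real.exp (-N * y)) atTop (𝓝 0) := by
      simp_rw [neg_mul]
      exact Real.tendsto_exp_neg_atTop_nhds_zero.comp
        (tendsto_natCast_atTop_atTop.atTop_mul_const hy)
    simpa using (h.const_sub 1).const_mul (Real.sin (ρ * y) / Real.sinh (y / 2))

/-- For every `ρ ∈ ℝ`, the function `y ↦ sin(ρ y)/sinh(y/2)` is integrable on `ℝ`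
and `∫_{-∞}^{+∞} sin(ρ y)/sinh(y/2) dy = 2π tanh(πρ)`.
(In Lean, division by zero is zero, so the formula below defines the function for `y ≠ 0`
and gives it the value `0` at the single point `y = 0`, which does not affect the
Lebesgue integral.) -/
theorem integral_sin_div_sinh (ρ : ℝ) :
    Integrable (fun y : ℝ => Real.sin (ρ * y) / Real.sinh (y / 2)) ∧
    ∫ y : ℝ, Real.sin (ρ * y) / Real.sinh (y / 2) = 2 * π * Real.tanh (π * ρ) := by
  refine ⟨integrable_sin_div_sinh ρ, ?_⟩
  have heven : ∀ y : ℝ, Real.sin (ρ * y) / Real.sinh (y / 2) =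
      Real.sin (ρ * |y|) / Real.sinh (|y| / 2) := by
    intro y
    rcases abs_choice y with h | h <;> rw [h]
    simp [neg_div, div_neg]
  rw [integral_congr_ae (ae_of_all _ heven),
    integral_comp_abs (f := fun y => Real.sin (ρ * y) / Real.sinh (y / 2)),
    integral_Ioi_sin_div_sinh, mul_assoc]
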